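/- arXiv:1407.7834 — 2 statements merged into one kernel-verified Lean document; each statement's English description precedes it below -/
import Mathlib

section
/- Let r ≥ 2, let F be the free group of rank r, and fix v ∈ F. The set of elements w ∈ F of length at least 5 such that the reduced word of v occurs as a contiguous sublist of the middle third of the reduced word of w is exponentially generic in F. -/
namespace VG

variable {r : ℕ}

/-- Word length: the length of the unique freely reduced word representing `w`. -/
def len (w : FreeGroup (Fin r)) : ℕ := (FreeGroup.toWord w).length

/-- The number of elements of `A` of word length at most `n`. -/
noncomputable def ballCount (A : Set (FreeGroup (Fin r))) (n : ℕ) : ℕ :=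
  {w | w ∈ A ∧ len w ≤ n}.ncard

/-- The number of elements of `A` of word length exactly `n`. -/
noncomputable def sphereCount (A : Set (FreeGroup (Fin r))) (n : ℕ) : ℕ :=
  {w | w ∈ A ∧ len w = n}.ncard

/-- `A` is exponentially generic in `B`: there are `a > 0` and `b` such that, for all
sufficiently large `n`, the proportion of elements of `B` of length at most `n` lying
in `A` is at least `1 - exp (b - a n)`. -/
def ExpGeneric (A B : Set (FreeGroup (Fin r))) : Prop :=
  ∃ a : ℝ, 0 < a ∧ ∃ b : ℝ, ∃ N : ℕ, ∀ n : ℕ, N ≤ n →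
    (1 : ℝ) - Real.exp (b - a * n) ≤ (ballCount A n : ℝ) / (ballCount B n)

/-- `A` is exponentially rare in `B` if its complement in `B` is exponentially generic. -/
def ExpRare (A B : Set (FreeGroup (Fin r))) : Prop := ExpGeneric (B \ A) B

/-- `v` is a subword of `w`: the reduced word of `v` is a contiguous sublist of that of `w`. -/
def Subword (v w : FreeGroup (Fin r)) : Prop :=
  FreeGroup.toWord v <:+: FreeGroup.toWord w

/-- `w` is cyclically reduced: the first letter of its reduced word is not the inverse of
the last letter. -/
def CyclicallyReduced (w : FreeGroup (Fin r)) : Prop :=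
  ∀ a ∈ (FreeGroup.toWord w).head?, ∀ b ∈ (FreeGroup.toWord w).getLast?,
    a ≠ (b.1, !b.2)

/-- `c` is the cyclic reduction of `w`: it is cyclically reduced and conjugate to `w`. -/
def IsCyclicReduction (c w : FreeGroup (Fin r)) : Prop :=
  CyclicallyReduced c ∧ ∃ g : FreeGroup (Fin r), w = g * c * g⁻¹

/-- Middle third of a list: delete the first and last `⌈l/3⌉` entries. -/
def middleThird {α : Type*} (l : List α) : List α :=
  (l.drop ((l.length + 2) / 3)).take (l.length - 2 * ((l.length + 2) / 3))

/-- `v` is cyclically contained in `w` if the reduced word of `v` is a subword of some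
positive power of the cyclic reduction of `w`. -/
def CyclicallyContains (w v : FreeGroup (Fin r)) : Prop :=
  ∃ c : FreeGroup (Fin r), IsCyclicReduction c w ∧ ∃ k : ℕ, 1 ≤ k ∧ Subword v (c ^ k)

/-- `w` is full: every freely reduced word of length 3, or its inverse, is cyclically
contained in `w`. -/
def Full (w : FreeGroup (Fin r)) : Prop :=
  ∀ t : FreeGroup (Fin r), len t = 3 → CyclicallyContains w t ∨ CyclicallyContains w t⁻¹

/-- The group element corresponding to a single letter. -/
def letterElem (a : Fin r × Bool) : FreeGroup (Fin r) := FreeGroup.mk [a]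

/-- The inverse of a letter. -/
def linv (a : Fin r × Bool) : Fin r × Bool := (a.1, !a.2)

/-- `w` is a proper power: `w = u^k` for some `k ≥ 2`. -/
def ProperPower (w : FreeGroup (Fin r)) : Prop :=
  ∃ u : FreeGroup (Fin r), ∃ k : ℕ, 2 ≤ k ∧ w = u ^ k

/-- Minimal word length in the conjugacy class of `w`. -/
noncomputable def conjMinLen (w : FreeGroup (Fin r)) : ℕ :=
  sInf (len '' {u | IsConj u w})

/-- `w` is Whitehead minimal: for every automorphism `α` of the free group, the length of
`w` is at most the minimal length of an element conjugate to `α w`. -/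
def WhiteheadMinimal (w : FreeGroup (Fin r)) : Prop :=
  ∀ α : FreeGroup (Fin r) ≃* FreeGroup (Fin r), len w ≤ conjMinLen (α w)



open FreeGroup in
/-- All reduced one-letter extensions (to the left) of the words of `T`. -/
noncomputable def extS (T : Finset (List (Fin r × Bool))) : Finset (List (Fin r × Bool)) := by
  classical
  exact T.biUnion (fun Y =>
    (Finset.univ.filter (fun a : Fin r × Bool => IsReduced (a :: Y))).image (fun a => a :: Y))

/-- The words of `T` are reduced and nonempty. -/
def GoodS (T : Finset (List (Fin r × Bool))) : Prop :=
  ∀ Y ∈ T, FreeGroup.IsReduced Y ∧ Y ≠ []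

theorem mem_extS {T : Finset (List (Fin r × Bool))} {l : List (Fin r × Bool)} :
    l ∈ extS T ↔ ∃ a Y, l = a :: Y ∧ Y ∈ T ∧ FreeGroup.IsReduced l := by
  classical
  simp only [extS, Finset.mem_biUnion, Finset.mem_image, Finset.mem_filter, Finset.mem_univ,
    true_and]
  constructor
  · rintro ⟨Y, hY, a, ha, rfl⟩
    exact ⟨a, Y, rfl, hY, ha⟩
  · rintro ⟨a, Y, rfl, hY, ha⟩
    exact ⟨Y, hY, a, ha, rfl⟩

theorem goodS_extS (T : Finset (List (Fin r × Bool))) : GoodS (extS T) := by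
  intro l hl
  obtain ⟨a, Y, rfl, _, h⟩ := mem_extS.1 hl
  exact ⟨h, by simp⟩

theorem goodS_iter {T : Finset (List (Fin r × Bool))} (hT : GoodS T) (t : ℕ) :
    GoodS (extS^[t] T) := by
  cases t with
  | zero => exact hT
  | succ t => rw [Function.iterate_succ_apply']; exact goodS_extS _

theorem card_extS {T : Finset (List (Fin r × Bool))} (hT : GoodS T) :
    (extS T).card = (2 * r - 1) * T.card := by
  classical
  unfold extS
  rw [Finset.card_biUnion]
  · rw [Finset.sum_congr rfl (g := fun _ => 2 * r - 1), Finset.sum_const, smul_eq_mul, mul_comm]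
    intro Y hY
    obtain ⟨h1, h2⟩ := hT Y hY
    rw [Finset.card_image_of_injective _ (fun a b h => by simpa using h)]
    obtain ⟨y, Y', rfl⟩ := List.exists_cons_of_ne_nil h2
    have : (Finset.univ.filter (fun a : Fin r × Bool => FreeGroup.IsReduced (a :: y :: Y')))
        = Finset.univ.erase (y.1, !y.2) := by
      ext ⟨a, b⟩
      obtain ⟨y1, y2⟩ := y
      unfold FreeGroup.IsReduced at *
      simp only [Finset.mem_filter, Finset.mem_univ, true_and, Finset.mem_erase,
        List.isChain_cons_cons, and_true, h1]
      cases b <;> cases y2 <;> simp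
    rw [this, Finset.card_erase_of_mem (Finset.mem_univ _)]
    simp [mul_comm]
  · intro Y _ Z _ hne
    rw [Function.onFun, Finset.disjoint_left]
    intro l h1 h2
    simp only [Finset.mem_image] at h1 h2
    obtain ⟨a, _, rfl⟩ := h1
    obtain ⟨b, _, h⟩ := h2
    exact hne (by simpa using (List.cons.inj h).2.symm)

theorem card_iter {T : Finset (List (Fin r × Bool))} (hT : GoodS T) (t : ℕ) :
    (extS^[t] T).card = (2 * r - 1) ^ t * T.card := by
  induction t with
  | zero => simp
  | succ t ih =>
    rw [Function.iterate_succ_apply', card_extS (goodS_iter hT t), ih, pow_succ]; ring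

theorem isReduced_right {X Y : List (Fin r × Bool)} (h : FreeGroup.IsReduced (X ++ Y)) :
    FreeGroup.IsReduced Y :=
  h.infix (List.suffix_append X Y).isInfix

theorem mem_iter {T : Finset (List (Fin r × Bool))} (X Y : List (Fin r × Bool))
    (hY : Y ∈ T) (h : FreeGroup.IsReduced (X ++ Y)) : X ++ Y ∈ extS^[X.length] T := by
  induction X with
  | nil => simpa using hY
  | cons a X ih =>
    rw [List.length_cons, Function.iterate_succ_apply']
    exact mem_extS.2 ⟨a, X ++ Y, rfl, ih (isReduced_right (X := [a]) h), h⟩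

theorem exists_letter (hr : 2 ≤ r) (p q : Fin r × Bool) : ∃ c : Fin r × Bool, c ≠ p ∧ c ≠ q := by
  classical
  have : ∃ c ∈ (Finset.univ : Finset (Fin r × Bool)), c ∉ ({p, q} : Finset (Fin r × Bool)) := by
    apply Finset.exists_mem_notMem_of_card_lt_card
    have := Finset.card_le_two (a := p) (b := q)
    simp
    omega
  obtain ⟨c, _, hc⟩ := this
  exact ⟨c, by simpa using hc⟩

theorem exists_link (hr : 2 ≤ r) (V Y : List (Fin r × Bool)) (hV : FreeGroup.IsReduced V)
    (hY : FreeGroup.IsReduced Y) : ∃ c, FreeGroup.IsReduced (V ++ c :: Y) := by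
  have d : Fin r × Bool := (⟨0, by omega⟩, true)
  obtain ⟨c, h1, h2⟩ := exists_letter hr
    (((V.getLast?).getD d).1, !((V.getLast?).getD d).2) ((Y.head?.getD d).1, !(Y.head?.getD d).2)
  refine ⟨c, ?_⟩
  unfold FreeGroup.IsReduced at *
  rw [List.isChain_append]
  refine ⟨hV, ?_, ?_⟩
  · rw [List.isChain_cons]
    refine ⟨?_, hY⟩
    intro y hy
    rw [Option.mem_def] at hy
    rw [hy] at h2
    obtain ⟨c1, c2⟩ := c
    obtain ⟨y1, y2⟩ := y
    rintro rfl
    cases c2 <;> cases y2 <;> simp_all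
  · intro y hy z hz
    rw [Option.mem_def] at hy
    rw [hy] at h1
    simp at hz
    subst hz
    obtain ⟨c1, c2⟩ := c
    obtain ⟨y1, y2⟩ := y
    rintro rfl
    cases c2 <;> cases y2 <;> simp_all

open Classical in
/-- A linking letter between `V` and `Y`. -/
noncomputable def link (V Y : List (Fin r × Bool)) : List (Fin r × Bool) :=
  if h : ∃ c, FreeGroup.IsReduced (V ++ c :: Y) then [h.choose] else []

theorem link_spec (hr : 2 ≤ r) (V Y : List (Fin r × Bool)) (hV : FreeGroup.IsReduced V)
    (hY : FreeGroup.IsReduced Y) :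
    (link V Y).length = 1 ∧ FreeGroup.IsReduced ((V ++ link V Y) ++ Y) := by
  have h := exists_link hr V Y hV hY
  unfold link
  rw [dif_pos h]
  exact ⟨rfl, by simpa using h.choose_spec⟩

open Classical in
/-- Extend by `|V|+1` letters, removing one extension containing `V`. -/
noncomputable def dropS (V : List (Fin r × Bool)) (T : Finset (List (Fin r × Bool))) :
    Finset (List (Fin r × Bool)) :=
  (extS^[V.length + 1] T) \ T.image (fun Y => (V ++ link V Y) ++ Y)

theorem goodS_dropS {T : Finset (List (Fin r × Bool))} (V : List (Fin r × Bool)) (hT : GoodS T) :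
    GoodS (dropS V T) := fun Y hY => goodS_iter hT _ Y (Finset.sdiff_subset hY)

theorem card_dropS (hr : 2 ≤ r) {T : Finset (List (Fin r × Bool))} (V : List (Fin r × Bool))
    (hV : FreeGroup.IsReduced V) (hT : GoodS T) :
    (dropS V T).card = ((2 * r - 1) ^ (V.length + 1) - 1) * T.card := by
  classical
  unfold dropS
  rw [Finset.card_sdiff_of_subset, card_iter hT, Finset.card_image_of_injOn, Nat.sub_mul, one_mul]
  · intro Y hY Z hZ h
    have h1 := link_spec hr V Y hV (hT Y hY).1
    have h2 := link_spec hr V Z hV (hT Z hZ).1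
    exact (List.append_inj h (by simp [h1.1, h2.1])).2
  · intro l hl
    obtain ⟨Y, hY, rfl⟩ := Finset.mem_image.1 hl
    have h1 := link_spec hr V Y hV (hT Y hY).1
    have := mem_iter (V ++ link V Y) Y hY h1.2
    simpa [h1.1] using this

theorem iter_dropS (hr : 2 ≤ r) {T : Finset (List (Fin r × Bool))} (V : List (Fin r × Bool))
    (hV : FreeGroup.IsReduced V) (hT : GoodS T) (j : ℕ) :
    GoodS ((dropS V)^[j] T) ∧
    ((dropS V)^[j] T).card = ((2 * r - 1) ^ (V.length + 1) - 1) ^ j * T.card := by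
  induction j with
  | zero => simpa using hT
  | succ j ih =>
    rw [Function.iterate_succ_apply']
    refine ⟨goodS_dropS V ih.1, ?_⟩
    rw [card_dropS hr V hV ih.1, ih.2, pow_succ]; ring

theorem mem_iter_dropS (hr : 2 ≤ r) {T : Finset (List (Fin r × Bool))} (V : List (Fin r × Bool))
    (hV : FreeGroup.IsReduced V) (hT : GoodS T) (Y : List (Fin r × Bool)) (hY : Y ∈ T) (j : ℕ)
    (M : List (Fin r × Bool)) (hM : M.length = j * (V.length + 1))
    (h : FreeGroup.IsReduced (M ++ Y)) (hn : ¬ V <:+: M) : M ++ Y ∈ (dropS V)^[j] T := by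
  classical
  induction j generalizing M with
  | zero =>
    have : M = [] := by simpa using hM
    simpa [this] using hY
  | succ j ih =>
    obtain ⟨M1, M2, rfl, h1, h2⟩ : ∃ M1 M2, M = M1 ++ M2 ∧ M1.length = V.length + 1 ∧
        M2.length = j * (V.length + 1) := by
      refine ⟨M.take (V.length + 1), M.drop (V.length + 1), by simp, ?_, ?_⟩
      · rw [List.length_take, hM, Nat.succ_mul]; omega
      · rw [List.length_drop, hM, Nat.succ_mul]; omega
    rw [List.append_assoc] at h ⊢
    have ih' := ih M2 h2 (isReduced_right h)
      (fun hi => hn (hi.trans (List.suffix_append M1 M2).isInfix))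
    rw [Function.iterate_succ_apply']
    rw [dropS, Finset.mem_sdiff]
    constructor
    · rw [← h1]; exact mem_iter M1 _ ih' h
    · intro hi
      obtain ⟨Z, hZ, hEq⟩ := Finset.mem_image.1 hi
      have hZ' := (iter_dropS hr V hV hT j).1 Z hZ
      have hl := link_spec hr V Z hV hZ'.1
      have := (List.append_inj hEq (by simp [hl.1, h1])).1
      exact hn ⟨[], link V Z ++ M2, by simp [← this]⟩

/-- One-letter words. -/
def oneS (r : ℕ) : Finset (List (Fin r × Bool)) :=
  Finset.univ.image (fun a => [a])

theorem goodS_oneS : GoodS (oneS r) := by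
  intro Y hY
  obtain ⟨a, _, rfl⟩ := Finset.mem_image.1 hY
  exact ⟨FreeGroup.IsReduced.singleton, by simp⟩

theorem card_oneS : (oneS r).card = 2 * r := by
  unfold oneS
  rw [Finset.card_image_of_injective _ (fun a b h => by simpa using h)]
  simp [mul_comm]

theorem mem_sphere {l : List (Fin r × Bool)} {n : ℕ} (hl : l.length = n + 1)
    (h : FreeGroup.IsReduced l) : l ∈ extS^[n] (oneS r) := by
  have hne : l ≠ [] := by rintro rfl; simp at hl
  have h1 := List.dropLast_append_getLast hne
  have := mem_iter (T := oneS r) l.dropLast [l.getLast hne] (by simp [oneS]) (by rwa [h1])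
  rw [h1] at this
  simpa [hl] using this

theorem length_sphere {l : List (Fin r × Bool)} {n : ℕ} (h : l ∈ extS^[n] (oneS r)) :
    l.length = n + 1 := by
  induction n generalizing l with
  | zero =>
    obtain ⟨a, _, rfl⟩ := Finset.mem_image.1 h
    rfl
  | succ n ih =>
    rw [Function.iterate_succ_apply'] at h
    obtain ⟨a, Y, rfl, hY, _⟩ := mem_extS.1 h
    simp [ih hY]

/-- A finite set containing all bad words of length `n ≥ 5`. -/
theorem bad_bound (hr : 2 ≤ r) (V : List (Fin r × Bool)) (hV : FreeGroup.IsReduced V)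
    (n : ℕ) (hn : 5 ≤ n) : ∃ (S : Finset (List (Fin r × Bool))) (p s j : ℕ),
    n = 2 * (p + 1) + s + j * (V.length + 1) ∧ n ≤ (3 * j + 3) * (V.length + 1) + 6 ∧
    (∀ l, FreeGroup.IsReduced l → l.length = n → ¬ V <:+: middleThird l → l ∈ S) ∧
    S.card = (2 * r - 1) ^ (p + 1 + s) * (((2 * r - 1) ^ (V.length + 1) - 1) ^ j *
      ((2 * r - 1) ^ p * (2 * r))) := by
  obtain ⟨p, hp⟩ : ∃ p, (n + 2) / 3 = p + 1 := ⟨(n + 2) / 3 - 1, by omega⟩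
  set k := V.length + 1 with hk
  set m := n - 2 * (p + 1) with hm
  have hmd := Nat.div_add_mod m k
  have hlt := Nat.mod_lt m (show 0 < k by omega)
  set j := m / k
  set s := m % k
  rw [mul_comm] at hmd
  have hT := goodS_iter (goodS_oneS (r := r)) p
  have hD := iter_dropS hr V hV hT j
  refine ⟨extS^[p + 1 + s] ((dropS V)^[j] (extS^[p] (oneS r))), p, s, j, by omega, ?_, ?_, ?_⟩
  · have : (3 * j + 3) * k = 3 * (j * k) + 3 * k := by ring
    omega
  · intro l hl hln hnot
    have hmt : middleThird l = (l.drop (p + 1)).take m := by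
      unfold middleThird; rw [hln, hp]
    rw [hmt] at hnot
    set M := (l.drop (p + 1)).take m with hM
    have hMl : M.length = m := by
      rw [hM, List.length_take, List.length_drop, hln]; omega
    have e1 : l = l.take (p + 1) ++ (M.take s ++ (M.drop s ++ l.drop (p + 1 + m))) := by
      rw [← List.append_assoc (M.take s), List.take_append_drop, hM, ← List.drop_drop (i := m) (j := p + 1),
        List.take_append_drop, List.take_append_drop]
    have hY : l.drop (p + 1 + m) ∈ extS^[p] (oneS r) :=
      mem_sphere (by rw [List.length_drop, hln]; omega)
        (hl.infix (List.drop_suffix _ _).isInfix)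
    have hl2 := hl
    rw [e1] at hl2
    have h2 := mem_iter_dropS hr V hV hT _ hY j (M.drop s)
      (by rw [List.length_drop, hMl, ← hk]; omega) (isReduced_right (isReduced_right hl2))
      (fun h => hnot (h.trans (List.drop_suffix _ _).isInfix))
    rw [← List.append_assoc] at hl2 e1
    have h3 := mem_iter _ _ h2 hl2
    rw [← e1, List.length_append, List.length_take, List.length_take, hMl, hln] at h3
    rwa [min_eq_left (by omega), min_eq_left (by omega)] at h3
  · rw [card_iter hD.1, hD.2, card_iter goodS_oneS, card_oneS]


theorem bad_bound_real (hr : 2 ≤ r) (V : List (Fin r × Bool)) (hV : FreeGroup.IsReduced V) :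
    ∃ a : ℝ, 0 < a ∧ a ≤ Real.log 2 ∧ ∃ C : ℝ, 0 < C ∧ ∀ n : ℕ,
      ∃ S : Finset (List (Fin r × Bool)),
        (∀ l, FreeGroup.IsReduced l → l.length = n → (n < 5 ∨ ¬ V <:+: middleThird l) → l ∈ S) ∧
        (S.card : ℝ) ≤ C * (((2 * r - 1 : ℕ) : ℝ) * Real.exp (-a)) ^ n := by
  have hq3 : 3 ≤ 2 * r - 1 := by omega
  have h2r : 2 * r ≤ 2 * (2 * r - 1) := by omega
  have hbb := bad_bound hr V hV
  have hcs : ∀ n, (extS^[n] (oneS r)).card = (2 * r - 1) ^ n * (2 * r) := fun n => by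
    rw [card_iter goodS_oneS, card_oneS]
  have hk : 1 ≤ V.length + 1 := by omega
  generalize V.length + 1 = k at hbb hk
  have h2r' : (((2 * r : ℕ)) : ℝ) ≤ 2 * ((2 * r - 1 : ℕ) : ℝ) := by exact_mod_cast h2r
  generalize 2 * r - 1 = q at hbb hcs hq3 h2r'
  have hq : (3 : ℝ) ≤ q := by exact_mod_cast hq3
  have hk' : (1 : ℝ) ≤ k := by exact_mod_cast hk
  have hqk : (1 : ℝ) < (q : ℝ) ^ k := one_lt_pow₀ (by linarith) (by omega)
  set θ : ℝ := 1 - ((q : ℝ) ^ k)⁻¹ with hθ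
  have hθ0 : 0 < θ := by
    have := inv_lt_one_of_one_lt₀ hqk
    linarith
  have hθ1 : θ < 1 := by
    have : 0 < ((q : ℝ) ^ k)⁻¹ := by positivity
    linarith
  have hlog := Real.log_neg hθ0 hθ1
  set a : ℝ := min (-Real.log θ / (3 * k)) (Real.log 2) with ha
  have ha0 : 0 < a := lt_min (div_pos (by linarith) (by linarith)) (Real.log_pos (by norm_num))
  have ha1 : a * (3 * k) ≤ -Real.log θ := by
    rw [← le_div_iff₀ (by linarith)]; exact min_le_left _ _
  refine ⟨a, ha0, min_le_right _ _, 2 * Real.exp (a * (3 * k + 6)), by positivity, ?_⟩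
  intro n
  have hx : ((q : ℝ) * Real.exp (-a)) ^ n = (q : ℝ) ^ n * Real.exp (-(a * n)) := by
    rw [mul_pow, ← Real.exp_nat_mul]; congr 2; ring
  -- the comparison
  have key : ∀ t : ℝ, t ≤ Real.exp (a * (3 * k + 6) - a * n) →
      2 * (q : ℝ) ^ n * t ≤ 2 * Real.exp (a * (3 * k + 6)) * ((q : ℝ) * Real.exp (-a)) ^ n := by
    intro t ht
    rw [hx]
    calc 2 * (q : ℝ) ^ n * t ≤ 2 * (q : ℝ) ^ n * Real.exp (a * (3 * k + 6) - a * n) := by gcongr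
      _ = _ := by rw [sub_eq_add_neg, Real.exp_add]; ring
  by_cases hn : n < 5
  · have h1 : (1 : ℝ) ≤ Real.exp (a * (3 * k + 6) - a * n) := by
      apply Real.one_le_exp
      have : (n : ℝ) < 5 := by exact_mod_cast hn
      nlinarith
    have h2 := key 1 h1
    cases n with
    | zero =>
      refine ⟨{[]}, fun l _ hl _ => by simpa using hl, ?_⟩
      refine le_trans ?_ h2
      simp
    | succ n =>
      refine ⟨extS^[n] (oneS r), fun l hl hl' _ => mem_sphere hl' hl, ?_⟩
      refine le_trans ?_ h2
      rw [hcs, Nat.cast_mul, Nat.cast_pow, pow_succ]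
      have : (0 : ℝ) < (q : ℝ) ^ n := by positivity
      nlinarith
  · obtain ⟨S, p, s, j, hn1, hn2, hS, hc⟩ := hbb n (by omega)
    refine ⟨S, fun l hl hl' h => hS l hl hl' (h.resolve_left hn), ?_⟩
    have hθj : θ ^ j ≤ Real.exp (a * (3 * k + 6) - a * n) := by
      rw [← Real.exp_log hθ0, ← Real.exp_nat_mul, Real.exp_le_exp]
      have e : (n : ℝ) ≤ (3 * j + 3) * k + 6 := by exact_mod_cast hn2
      have e1 := mul_le_mul_of_nonneg_left e ha0.le
      have e2 := mul_le_mul_of_nonneg_left ha1 (Nat.cast_nonneg (α := ℝ) j)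
      nlinarith
    refine le_trans ?_ (key _ hθj)
    have hone : 1 ≤ q ^ k := Nat.one_le_pow _ _ (by omega)
    have hsub : (((q ^ k - 1 : ℕ)) : ℝ) = (q : ℝ) ^ k * θ := by
      rw [Nat.cast_sub hone, hθ, mul_sub, mul_inv_cancel₀ (by positivity)]
      simp
    rw [hc]
    simp only [Nat.cast_mul, Nat.cast_pow, hsub] at h2r' ⊢
    calc (q : ℝ) ^ (p + 1 + s) * (((q : ℝ) ^ k * θ) ^ j * ((q : ℝ) ^ p * ((2 : ℕ) * r)))
        ≤ (q : ℝ) ^ (p + 1 + s) * (((q : ℝ) ^ k * θ) ^ j * ((q : ℝ) ^ p * (2 * q))) := by gcongr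
      _ = 2 * (q : ℝ) ^ n * θ ^ j := by
        rw [hn1, mul_pow, ← pow_mul, mul_comm k j]; ring

theorem finite_ball (r n : ℕ) : {w : FreeGroup (Fin r) | len w ≤ n}.Finite := by
  have h : (⋃ i ∈ Finset.range (n + 1), {l : List (Fin r × Bool) | l.length = i}).Finite :=
    Set.Finite.biUnion (Finset.finite_toSet _) (fun i _ => List.finite_length_eq _ i)
  refine Set.Finite.of_finite_image (f := FreeGroup.toWord) (h.subset ?_)
    FreeGroup.toWord_injective.injOn
  rintro _ ⟨w, hw, rfl⟩
  simp only [Set.mem_iUnion, Finset.mem_range, Set.mem_ofPred_eq, exists_prop]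
  exact ⟨_, Nat.lt_succ_of_le hw, rfl⟩

theorem ball_lower (hr : 2 ≤ r) (n : ℕ) :
    (2 * r - 1) ^ (n + 1) ≤ {w : FreeGroup (Fin r) | len w ≤ n + 1}.ncard := by
  have hc : (extS^[n] (oneS r)).card = (2 * r - 1) ^ n * (2 * r) := by
    rw [card_iter goodS_oneS, card_oneS]
  have hle : (extS^[n] (oneS r)).card ≤ {w : FreeGroup (Fin r) | len w ≤ n + 1}.ncard := by
    rw [← Set.ncard_coe_finset]
    refine Set.ncard_le_ncard_of_injOn FreeGroup.mk ?_ ?_ (finite_ball r (n + 1))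
    · intro l hl
      have h1 := (goodS_iter (goodS_oneS (r := r)) n l hl).1.reduce_eq
      have h2 := length_sphere hl
      simp [len, h1, h2]
    · intro l hl l' hl' h
      have h1 := (goodS_iter (goodS_oneS (r := r)) n l hl).1.reduce_eq
      have h2 := (goodS_iter (goodS_oneS (r := r)) n l' hl').1.reduce_eq
      rw [← h1, ← h2]
      exact FreeGroup.reduce.sound h
  refine le_trans ?_ hle
  rw [hc, pow_succ]
  exact Nat.mul_le_mul_left _ (by omega)

/-- the set of elements of length at least 5 containing `v` as a subword of
the middle third of their reduced word is exponentially generic in `F`. -/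
theorem middleThird_subword_expGeneric {r : ℕ} (hr : 2 ≤ r) (v : FreeGroup (Fin r)) :
    ExpGeneric
      {w : FreeGroup (Fin r) | 5 ≤ len w ∧
        FreeGroup.toWord v <:+: middleThird (FreeGroup.toWord w)}
      (Set.univ : Set (FreeGroup (Fin r))) := by
  classical
  obtain ⟨a, ha, ha2, C, hC, hb⟩ := bad_bound_real hr (FreeGroup.toWord v)
    FreeGroup.isReduced_toWord
  choose S hS hcard using hb
  set q : ℝ := ((2 * r - 1 : ℕ) : ℝ) with hq
  have hq3 : (3 : ℝ) ≤ q := by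
    have : 3 ≤ 2 * r - 1 := by omega
    rw [hq]
    exact_mod_cast this
  set x : ℝ := q * Real.exp (-a) with hx
  have hx1 : 3 / 2 ≤ x := by
    have : Real.exp (-Real.log 2) ≤ Real.exp (-a) := Real.exp_le_exp.2 (by linarith)
    rw [Real.exp_neg, Real.exp_log (by norm_num)] at this
    nlinarith
  refine ⟨a, ha, Real.log (2 * C * x), 1, ?_⟩
  intro n hn
  set A : Set (FreeGroup (Fin r)) := {w : FreeGroup (Fin r) | 5 ≤ len w ∧
        FreeGroup.toWord v <:+: middleThird (FreeGroup.toWord w)} with hA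
  have hfin := finite_ball r n
  have hU : ballCount (Set.univ : Set (FreeGroup (Fin r))) n
      = {w : FreeGroup (Fin r) | len w ≤ n}.ncard := by simp [ballCount]
  have hlow : q ^ n ≤ (ballCount (Set.univ : Set (FreeGroup (Fin r))) n : ℝ) := by
    rw [hU]
    obtain ⟨m, rfl⟩ : ∃ m, n = m + 1 := ⟨n - 1, by omega⟩
    have := ball_lower hr m
    rw [hq]
    exact_mod_cast this
  have hsum : ballCount A n + {w | w ∉ A ∧ len w ≤ n}.ncard
      = ballCount (Set.univ : Set (FreeGroup (Fin r))) n := by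
    rw [hU, ballCount, ← Set.ncard_union_eq (hs := hfin.subset (fun w h => h.2))
      (ht := hfin.subset (fun w h => h.2))]
    · congr 1
      ext w
      simp only [Set.mem_union, Set.mem_ofPred_eq]
      tauto
    · rw [Set.disjoint_left]
      intro w h1 h2
      exact h2.1 h1.1
  have hbad : {w | w ∉ A ∧ len w ≤ n}.ncard ≤ ∑ i ∈ Finset.range (n + 1), (S i).card := by
    refine le_trans ?_ (Finset.card_biUnion_le (s := Finset.range (n + 1)) (t := S))
    rw [← Set.ncard_coe_finset]
    refine Set.ncard_le_ncard_of_injOn FreeGroup.toWord ?_ FreeGroup.toWord_injective.injOn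
      (Finset.finite_toSet _)
    intro w hw
    rw [Finset.mem_coe, Finset.mem_biUnion]
    refine ⟨len w, Finset.mem_range.2 (Nat.lt_succ_of_le hw.2), ?_⟩
    refine hS _ _ FreeGroup.isReduced_toWord rfl ?_
    by_contra hcon
    rw [not_or, not_not, not_lt] at hcon
    exact hw.1 hcon
  have hbad2 : (({w | w ∉ A ∧ len w ≤ n}.ncard : ℕ) : ℝ) ≤ 2 * C * x * x ^ n := by
    calc (({w | w ∉ A ∧ len w ≤ n}.ncard : ℕ) : ℝ)
        ≤ ∑ i ∈ Finset.range (n + 1), ((S i).card : ℝ) := by exact_mod_cast hbad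
      _ ≤ ∑ i ∈ Finset.range (n + 1), C * x ^ i := Finset.sum_le_sum (fun i _ => hcard i)
      _ = C * ((x ^ (n + 1) - 1) / (x - 1)) := by
          rw [← Finset.mul_sum, geom_sum_eq (by linarith)]
      _ ≤ C * (2 * x ^ (n + 1)) := by
          refine mul_le_mul_of_nonneg_left ?_ hC.le
          rw [div_le_iff₀ (by linarith)]
          have : 0 < x ^ (n + 1) := by positivity
          nlinarith
      _ = 2 * C * x * x ^ n := by ring
  have hxn : x ^ n = q ^ n * Real.exp (-(a * n)) := by
    rw [hx, mul_pow, ← Real.exp_nat_mul]; congr 2; ring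
  have hexp : Real.exp (Real.log (2 * C * x) - a * n) = 2 * C * x * Real.exp (-(a * n)) := by
    rw [sub_eq_add_neg, Real.exp_add, Real.exp_log (by positivity)]
  have hqn : 0 < q ^ n := by positivity
  have hpos : (0 : ℝ) < (ballCount (Set.univ : Set (FreeGroup (Fin r))) n : ℝ) := by linarith
  rw [le_div_iff₀ hpos, hexp]
  have hsum' : (ballCount A n : ℝ) + (({w | w ∉ A ∧ len w ≤ n}.ncard : ℕ) : ℝ)
      = (ballCount (Set.univ : Set (FreeGroup (Fin r))) n : ℝ) := by exact_mod_cast hsum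
  have hfinal : 2 * C * x * x ^ n ≤ 2 * C * x * Real.exp (-(a * n)) *
      (ballCount (Set.univ : Set (FreeGroup (Fin r))) n : ℝ) := by
    rw [hxn]
    calc 2 * C * x * (q ^ n * Real.exp (-(a * n)))
        = 2 * C * x * Real.exp (-(a * n)) * q ^ n := by ring
      _ ≤ _ := by gcongr
  linarith

end VG
end

section
/- Let r ≥ 2, let F be the free group of rank r, and fix v ∈ F. The set of elements w ∈ F such that the reduced word of v occurs as a contiguous sublist of the reduced word of the cyclic reduction of w is exponentially generic in F. -/
namespace VG

variable {r : ℕ}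

section Helpers

open FreeGroup

open scoped Classical in
/-- All reduced words obtained from `p` by prepending `M` letters. -/
noncomputable def extWords (p : List (Fin r × Bool)) : ℕ → Finset (List (Fin r × Bool))
  | 0 => {p}
  | M + 1 => (extWords p M).biUnion fun l =>
      (Finset.univ.filter fun x : Fin r × Bool => IsReduced (x :: l)).image fun x => x :: l

lemma mem_extWords {p : List (Fin r × Bool)} (hp : IsReduced p) (M : ℕ)
    (l : List (Fin r × Bool)) :
    l ∈ extWords p M ↔ IsReduced l ∧ ∃ s : List (Fin r × Bool), s.length = M ∧ l = s ++ p := by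
  induction M generalizing l with
  | zero =>
    simp only [extWords, Finset.mem_singleton, List.length_eq_zero_iff]
    constructor
    · rintro rfl; exact ⟨hp, [], rfl, rfl⟩
    · rintro ⟨_, s, rfl, rfl⟩; rfl
  | succ M ih =>
    simp only [extWords, Finset.mem_biUnion, Finset.mem_image, Finset.mem_filter,
      Finset.mem_univ, true_and]
    constructor
    · rintro ⟨l', hl', x, hx, rfl⟩
      obtain ⟨_, s, hs, rfl⟩ := (ih _).1 hl'
      exact ⟨hx, x :: s, by simp [hs], rfl⟩
    · rintro ⟨hl, s, hs, rfl⟩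
      cases s with
      | nil => simp at hs
      | cons x s =>
        refine ⟨s ++ p, (ih _).2 ⟨hl.infix ⟨[x], [], by simp⟩, s, by simpa using hs, rfl⟩,
          x, hl, rfl⟩

lemma reduced_cons_iff (x y : Fin r × Bool) (l : List (Fin r × Bool)) (h : IsReduced (y :: l)) :
    IsReduced (x :: y :: l) ↔ x ≠ (y.1, !y.2) := by
  rw [isReduced_cons_cons]
  obtain ⟨x1, x2⟩ := x
  obtain ⟨y1, y2⟩ := y
  simp only [h, and_true, ne_eq, Prod.mk.injEq, not_and]
  cases x2 <;> cases y2 <;> simp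

open scoped Classical in
lemma card_ext_letter {l : List (Fin r × Bool)} (hl : IsReduced l) (hne : l ≠ []) :
    (Finset.univ.filter fun x : Fin r × Bool => IsReduced (x :: l)).card = 2 * r - 1 := by
  cases l with
  | nil => exact absurd rfl hne
  | cons y l =>
    simp_rw [reduced_cons_iff _ y l hl]
    rw [Finset.filter_ne', Finset.card_erase_of_mem (Finset.mem_univ _)]
    simp [mul_comm]

open scoped Classical in
lemma card_ext_letter_ge {l : List (Fin r × Bool)} (hl : IsReduced l) :
    2 * r - 1 ≤ (Finset.univ.filter fun x : Fin r × Bool => IsReduced (x :: l)).card := by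
  by_cases h : l = []
  · subst h
    simp [mul_comm]
  · exact (card_ext_letter hl h).ge

lemma card_extWords_le {p : List (Fin r × Bool)} (hp : IsReduced p) (hne : p ≠ []) (M : ℕ) :
    (extWords p M).card ≤ (2 * r - 1) ^ M := by
  classical
  induction M with
  | zero => simp [extWords]
  | succ M ih =>
    rw [extWords, pow_succ]
    refine (Finset.card_biUnion_le_card_mul _ _ (2 * r - 1) ?_).trans
      (Nat.mul_le_mul_right _ ih)
    intro l hl
    obtain ⟨hr, s, -, rfl⟩ := (mem_extWords hp M l).1 hl
    refine Finset.card_image_le.trans (card_ext_letter hr (by simp [hne])).le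

lemma card_words_le (hr : 2 ≤ r) (n : ℕ) :
    (extWords ([] : List (Fin r × Bool)) n).card ≤ 2 * r * (2 * r - 1) ^ n := by
  classical
  induction n with
  | zero => simp [extWords]; omega
  | succ n ih =>
    rw [extWords, pow_succ, ← mul_assoc]
    rcases Nat.eq_zero_or_pos n with rfl | hn
    · simp only [extWords, Finset.singleton_biUnion]
      refine Finset.card_image_le.trans ((Finset.card_le_univ _).trans ?_)
      simp
      nlinarith [Nat.mul_le_mul_left (r * 2) (show 1 ≤ 2 * r - 1 by omega)]
    · refine (Finset.card_biUnion_le_card_mul _ _ (2 * r - 1) ?_).trans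
        (Nat.mul_le_mul_right _ ih)
      intro l hl
      obtain ⟨hr, s, hs, rfl⟩ := (mem_extWords IsReduced.nil n l).1 hl
      refine Finset.card_image_le.trans (card_ext_letter hr ?_).le
      rintro h
      simp at h
      subst h
      simp at hs
      omega

lemma card_words_ge (n : ℕ) :
    (2 * r - 1) ^ n ≤ (extWords ([] : List (Fin r × Bool)) n).card := by
  classical
  induction n with
  | zero => simp [extWords]
  | succ n ih =>
    rw [extWords, pow_succ, Finset.card_biUnion]
    · refine (Nat.mul_le_mul_right _ ih).trans ?_
      rw [← smul_eq_mul]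
      refine Finset.card_nsmul_le_sum _ _ _ fun l hl => ?_
      rw [Finset.card_image_of_injective _ (fun a b h => by simpa using h)]
      exact card_ext_letter_ge ((mem_extWords IsReduced.nil n l).1 hl).1
    · intro l _ l' _ hne
      simp only [Function.onFun]
      rw [Finset.disjoint_left]
      intro z hz hz'
      simp only [Finset.mem_image] at hz hz'
      obtain ⟨x, _, rfl⟩ := hz
      obtain ⟨y, _, h⟩ := hz'
      simp at h
      exact hne h.2.symm

lemma mem_words (n : ℕ) (l : List (Fin r × Bool)) :
    l ∈ extWords ([] : List (Fin r × Bool)) n ↔ IsReduced l ∧ l.length = n := by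
  rw [mem_extWords IsReduced.nil]
  simp only [List.append_nil]
  constructor
  · rintro ⟨h, s, hs, rfl⟩; exact ⟨h, hs⟩
  · rintro ⟨h, hs⟩; exact ⟨h, l, hs, rfl⟩

open scoped Classical in
/-- Reduced words of length `n` avoiding `u`. -/
noncomputable def avoidWords (u : List (Fin r × Bool)) (n : ℕ) : Finset (List (Fin r × Bool)) :=
  (extWords [] n).filter fun l => ¬ u <:+: l

lemma exists_ext (hr : 2 ≤ r) {u p : List (Fin r × Bool)} (hu : IsReduced u) (hp : IsReduced p) :
    ∃ x : Fin r × Bool, IsReduced (u ++ x :: p) := by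
  classical
  have key : ∃ x : Fin r × Bool, (∀ a ∈ u.getLast?, a.1 = x.1 → a.2 = x.2) ∧
      (∀ b ∈ p.head?, x.1 = b.1 → x.2 = b.2) := by
    let i0 : Fin r := ⟨0, by omega⟩
    let i1 : Fin r := ⟨1, by omega⟩
    have h01 : i0 ≠ i1 := by simp [i0, i1]
    rcases hA : u.getLast? with _ | a
    · rcases hB : p.head? with _ | b
      · exact ⟨(i0, true), by simp, by simp⟩
      · exact ⟨b, by simp, by simp⟩
    · rcases hB : p.head? with _ | b
      · exact ⟨a, by simp, by simp⟩
      · by_cases hab : a.1 = b.1 → a.2 = b.2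
        · exact ⟨a, by simp, by simpa using hab⟩
        · have : ∃ i : Fin r, i ≠ a.1 := by
            by_cases h : i0 = a.1
            · exact ⟨i1, fun h' => h01 (h.trans h'.symm)⟩
            · exact ⟨i0, h⟩
          obtain ⟨i, hi⟩ := this
          have hb : a.1 = b.1 := by by_contra h; exact hab fun h' => absurd h' h
          refine ⟨(i, true), ?_, ?_⟩
          · simp only [Option.mem_def, Option.some.injEq]
            rintro _ rfl h; exact absurd h.symm hi
          · simp only [Option.mem_def, Option.some.injEq]
            rintro _ rfl h; exact absurd (h.trans hb.symm) hi
  obtain ⟨x, h1, h2⟩ := key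
  refine ⟨x, ?_⟩
  unfold FreeGroup.IsReduced at *
  rw [List.isChain_append]
  refine ⟨hu, ?_, ?_⟩
  · rw [List.isChain_cons]
    exact ⟨h2, hp⟩
  · intro a ha b hb
    simp at hb
    subst hb
    exact h1 a ha

lemma card_avoid_step (hr : 2 ≤ r) {u : List (Fin r × Bool)} (hu : IsReduced u) (n : ℕ)
    (hn : 1 ≤ n) :
    (avoidWords u (n + (u.length + 1))).card ≤
      (avoidWords u n).card * ((2 * r - 1) ^ (u.length + 1) - 1) := by
  classical
  have hsub : avoidWords u (n + (u.length + 1)) ⊆ (avoidWords u n).biUnion fun p =>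
      (extWords p (u.length + 1)).filter fun l => ¬ u <:+: l := by
    intro l hl
    simp only [avoidWords, Finset.mem_filter, mem_words, Finset.mem_biUnion] at hl ⊢
    obtain ⟨⟨hl, hlen⟩, hav⟩ := hl
    have hsplit : l.take (u.length + 1) ++ l.drop (u.length + 1) = l := List.take_append_drop _ _
    have hinf : l.drop (u.length + 1) <:+: l := (List.drop_suffix _ _).isInfix
    refine ⟨l.drop (u.length + 1), ⟨⟨hl.infix hinf, by simp [hlen]⟩,
      fun h => hav (h.trans hinf)⟩, ?_, hav⟩
    rw [mem_extWords (hl.infix hinf)]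
    exact ⟨hl, l.take (u.length + 1), by simp [hlen], hsplit.symm⟩
  refine (Finset.card_le_card hsub).trans (Finset.card_biUnion_le_card_mul _ _ _ ?_)
  intro p hp
  simp only [avoidWords, Finset.mem_filter, mem_words] at hp
  obtain ⟨⟨hp, hlen⟩, -⟩ := hp
  have hne : p ≠ [] := by rintro rfl; simp at hlen; omega
  obtain ⟨x, hx⟩ := exists_ext hr hu hp
  have hmem : u ++ x :: p ∈ extWords p (u.length + 1) := by
    rw [mem_extWords hp]
    exact ⟨hx, u ++ [x], by simp, by simp⟩
  have h2 : (extWords p (u.length + 1)).filter (fun l => ¬ u <:+: l) ⊆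
      (extWords p (u.length + 1)).erase (u ++ x :: p) := by
    intro l hl
    simp only [Finset.mem_filter] at hl
    refine Finset.mem_erase.2 ⟨?_, hl.1⟩
    rintro rfl
    exact hl.2 (List.prefix_append _ _).isInfix
  refine (Finset.card_le_card h2).trans ?_
  rw [Finset.card_erase_of_mem hmem]
  exact Nat.sub_le_sub_right (card_extWords_le hp hne _) 1

lemma exists_rho (q : ℝ) (hq : 3 ≤ q) (M : ℕ) (hM : 1 ≤ M) :
    ∃ ρ : ℝ, 1 ≤ ρ ∧ ρ < q ∧ q ≤ ρ ^ 2 ∧ q ^ M - 1 ≤ ρ ^ M := by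
  have hqM : q ≤ q ^ M := le_self_pow₀ (by linarith) (by omega)
  have hM' : (1 : ℝ) ≤ M := by exact_mod_cast hM
  have hpos : 0 < (M : ℝ) * q ^ M := by positivity
  have h3 : 3 ≤ (M : ℝ) * q ^ M := by nlinarith
  set ε : ℝ := 1 / (M * q ^ M) with hε
  have hε0 : 0 < ε := by positivity
  have hε1 : ε ≤ 1 / 3 := by
    rw [hε]; exact one_div_le_one_div_of_le (by norm_num) h3
  have hlow : 2 / 3 * q ≤ q * (1 - ε) := by nlinarith
  refine ⟨q * (1 - ε), by linarith, by nlinarith, by nlinarith, ?_⟩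
  rw [mul_pow]
  have hb := one_add_mul_le_pow (a := -ε) (by linarith) M
  have : q ^ M * (1 + M * -ε) = q ^ M - 1 := by
    rw [hε]; field_simp; ring
  rw [← this]
  exact mul_le_mul_of_nonneg_left (by simpa [sub_eq_add_neg] using hb) (by positivity)

lemma avoid_bound {u : List (Fin r × Bool)} (hr : 2 ≤ r) (hu : IsReduced u) (ρ : ℝ) (h1 : 1 ≤ ρ)
    (hρ : ((2 * r - 1 : ℕ) : ℝ) ^ (u.length + 1) - 1 ≤ ρ ^ (u.length + 1)) :
    ∃ C : ℝ, 0 < C ∧ ∀ n, ((avoidWords u n).card : ℝ) ≤ C * ρ ^ n := by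
  have hS : ∀ n ∈ Finset.range (u.length + 2), ((avoidWords u n).card : ℝ) ≤
      ∑ i ∈ Finset.range (u.length + 2), ((avoidWords u i).card : ℝ) := fun n hn =>
    Finset.single_le_sum (f := fun i => ((avoidWords u i).card : ℝ)) (fun _ _ => Nat.cast_nonneg _) hn
  have hS0 : 0 ≤ ∑ i ∈ Finset.range (u.length + 2), ((avoidWords u i).card : ℝ) :=
    Finset.sum_nonneg fun _ _ => Nat.cast_nonneg _
  generalize (∑ i ∈ Finset.range (u.length + 2), ((avoidWords u i).card : ℝ)) = S at hS hS0
  refine ⟨S + 1, by linarith, fun n => ?_⟩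
  induction n using Nat.strong_induction_on with
  | _ n ih =>
    by_cases hn : n < u.length + 2
    · have := hS n (Finset.mem_range.2 hn)
      have h2 : 1 ≤ ρ ^ n := one_le_pow₀ h1
      nlinarith
    · obtain ⟨m, rfl⟩ : ∃ m, n = m + (u.length + 1) := ⟨n - (u.length + 1), by omega⟩
      have hstep := card_avoid_step hr hu m (by omega)
      have h3 : 1 ≤ (2 * r - 1) ^ (u.length + 1) := Nat.one_le_pow _ _ (by omega)
      have hstep' : ((avoidWords u (m + (u.length + 1))).card : ℝ) ≤
          (avoidWords u m).card * (((2 * r - 1 : ℕ) : ℝ) ^ (u.length + 1) - 1) := by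
        have : ((avoidWords u (m + (u.length + 1))).card : ℝ) ≤
          (((avoidWords u m).card * ((2 * r - 1) ^ (u.length + 1) - 1) : ℕ) : ℝ) := by
          exact_mod_cast hstep
        rw [Nat.cast_mul, Nat.cast_sub h3, Nat.cast_pow, Nat.cast_one] at this
        exact this
      have him := ih m (by omega)
      calc _ ≤ _ := hstep'
        _ ≤ (avoidWords u m).card * ρ ^ (u.length + 1) := by gcongr
        _ ≤ ((S + 1) * ρ ^ m) * ρ ^ (u.length + 1) := by gcongr
        _ = _ := by ring

open scoped Classical in
/-- A finite set containing all reduced words of length `n` whose cyclic reduction avoids `u`. -/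
noncomputable def badWords (u : List (Fin r × Bool)) (n : ℕ) : Finset (List (Fin r × Bool)) :=
  (Finset.range (n / 2 + 1)).biUnion fun k =>
    (extWords [] k ×ˢ avoidWords u (n - 2 * k)).image fun gc => gc.1 ++ gc.2 ++ invRev gc.1

lemma card_bad {u : List (Fin r × Bool)} (hr : 2 ≤ r) (ρ C : ℝ) (hC : 0 < C) (h1 : 1 ≤ ρ)
    (hρ : ((2 * r - 1 : ℕ) : ℝ) ≤ ρ ^ 2)
    (hav : ∀ n, ((avoidWords u n).card : ℝ) ≤ C * ρ ^ n) (n : ℕ) :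
    ((badWords u n).card : ℝ) ≤ (n + 1) * (2 * r * C * ρ ^ n) := by
  classical
  have h : (badWords u n).card ≤ ∑ k ∈ Finset.range (n / 2 + 1),
      (extWords ([] : List (Fin r × Bool)) k).card * (avoidWords u (n - 2 * k)).card := by
    refine Finset.card_biUnion_le.trans (Finset.sum_le_sum fun k _ => ?_)
    exact Finset.card_image_le.trans (Finset.card_product _ _).le
  have h' : ((badWords u n).card : ℝ) ≤ ∑ k ∈ Finset.range (n / 2 + 1),
      ((extWords ([] : List (Fin r × Bool)) k).card : ℝ) * (avoidWords u (n - 2 * k)).card := by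
    exact_mod_cast h
  refine h'.trans ?_
  have hterm : ∀ k ∈ Finset.range (n / 2 + 1),
      ((extWords ([] : List (Fin r × Bool)) k).card : ℝ) * (avoidWords u (n - 2 * k)).card ≤
        2 * r * C * ρ ^ n := by
    intro k hk
    have hk' : 2 * k ≤ n := by simp at hk; omega
    have hw : ((extWords ([] : List (Fin r × Bool)) k).card : ℝ) ≤
        2 * r * ((2 * r - 1 : ℕ) : ℝ) ^ k := by exact_mod_cast card_words_le hr k
    calc _ ≤ (2 * r * ((2 * r - 1 : ℕ) : ℝ) ^ k) * (C * ρ ^ (n - 2 * k)) := by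
          gcongr; exact hav _
      _ ≤ (2 * r * (ρ ^ 2) ^ k) * (C * ρ ^ (n - 2 * k)) := by gcongr
      _ = 2 * r * C * (ρ ^ (2 * k) * ρ ^ (n - 2 * k)) := by rw [← pow_mul]; ring
      _ = _ := by rw [← pow_add, Nat.add_sub_cancel' hk']
  refine (Finset.sum_le_card_nsmul _ _ _ hterm).trans ?_
  rw [nsmul_eq_mul, Finset.card_range]
  gcongr
  push_cast
  have : ((n / 2 : ℕ) : ℝ) ≤ n := by exact_mod_cast Nat.div_le_self n 2
  linarith

lemma mem_bad (v w : FreeGroup (Fin r))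
    (hw : ¬ ∃ c : FreeGroup (Fin r), IsCyclicReduction c w ∧ Subword v c) :
    w.toWord ∈ badWords v.toWord (len w) := by
  classical
  have hdec := reduceCyclically.conj_conjugator_reduceCyclically w.toWord
  have hred : IsReduced w.toWord := isReduced_toWord
  have hcyc := reduceCyclically.isCyclicallyReduced hred
  set c := reduceCyclically w.toWord
  set g := reduceCyclically.conjugator w.toWord
  have hg : IsReduced g := hred.infix ⟨[], c ++ invRev g, by simpa using hdec⟩
  have hcw : (FreeGroup.mk c).toWord = c := by
    rw [toWord_mk]; exact hcyc.isReduced.reduce_eq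
  have hlen : len w = 2 * g.length + c.length := by
    have := congrArg List.length hdec
    simp only [List.length_append, invRev_length] at this
    unfold len; omega
  have hav : ¬ v.toWord <:+: c := by
    intro h
    refine hw ⟨FreeGroup.mk c, ⟨?_, FreeGroup.mk g, ?_⟩, ?_⟩
    · unfold CyclicallyReduced
      rw [hcw]
      intro a ha b hb hab
      have := hcyc.2 b hb a ha (by rw [hab])
      rw [hab] at this
      simp at this
    · rw [inv_mk, mul_mk, mul_mk, hdec, mk_toWord]
    · unfold Subword
      rw [hcw]; exact h
  unfold badWords
  simp only [Finset.mem_biUnion, Finset.mem_image, Finset.mem_product, Finset.mem_range,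
    avoidWords, Finset.mem_filter, mem_words]
  exact ⟨g.length, by omega, (g, c), ⟨⟨hg, rfl⟩, ⟨⟨hcyc.isReduced, by show c.length = _; omega⟩, hav⟩⟩, hdec⟩

lemma exp_bound (D x : ℝ) (hD : 0 < D) (hx0 : 0 < x) (hx1 : x < 1) :
    ∃ a : ℝ, 0 < a ∧ ∃ b : ℝ, ∀ n : ℕ, D * ((n : ℝ) + 1) ^ 2 * x ^ n ≤ Real.exp (b - a * n) := by
  set y := Real.sqrt x
  have hy0 : 0 < y := Real.sqrt_pos.2 hx0
  have hyy : y * y = x := Real.mul_self_sqrt hx0.le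
  have hy1 : y < 1 := by nlinarith
  have ht := tendsto_pow_const_mul_const_pow_of_lt_one 2 hy0.le hy1
  have ht' := (Filter.tendsto_add_atTop_iff_nat 1).2 ht
  obtain ⟨K, hK⟩ := ht'.bddAbove_range
  have hK' : ∀ n : ℕ, ((n : ℝ) + 1) ^ 2 * y ^ (n + 1) ≤ K := fun n => by
    have := hK ⟨n, rfl⟩
    simpa using this
  have hKpos : 0 < K := lt_of_lt_of_le (by positivity) (hK' 0)
  refine ⟨-Real.log y, by linarith [Real.log_neg hy0 hy1], Real.log (D * K / y), fun n => ?_⟩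
  have he : Real.exp (Real.log (D * K / y) - -Real.log y * n) = D * K / y * y ^ n := by
    rw [show Real.log (D * K / y) - -Real.log y * n = Real.log (D * K / y) + n * Real.log y by ring,
      Real.exp_add, Real.exp_log (by positivity), Real.exp_nat_mul, Real.exp_log hy0]
  rw [he, ← hyy, mul_pow]
  have h2 : ((n : ℝ) + 1) ^ 2 * y ^ n ≤ K / y := by
    rw [le_div_iff₀ hy0]
    have := hK' n
    rw [pow_succ y n] at this
    linarith
  calc D * ((n : ℝ) + 1) ^ 2 * (y ^ n * y ^ n) = D * (((n : ℝ) + 1) ^ 2 * y ^ n) * y ^ n := by ring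
    _ ≤ D * (K / y) * y ^ n := by gcongr
    _ = _ := by ring

lemma ball_finite (A : Set (FreeGroup (Fin r))) (n : ℕ) : {w | w ∈ A ∧ len w ≤ n}.Finite := by
  classical
  refine Set.Finite.of_finite_image (f := FreeGroup.toWord) ?_ toWord_injective.injOn
  refine ((Finset.range (n + 1)).biUnion (fun k => extWords [] k)).finite_toSet.subset ?_
  rintro _ ⟨w, ⟨_, hw⟩, rfl⟩
  simp only [Finset.coe_biUnion, Set.mem_iUnion, Finset.mem_coe, mem_words, Finset.mem_range]
  exact ⟨len w, by omega, isReduced_toWord, rfl⟩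

lemma ball_univ_ge (n : ℕ) :
    (2 * r - 1) ^ n ≤ ballCount (Set.univ : Set (FreeGroup (Fin r))) n := by
  classical
  refine (card_words_ge n).trans ?_
  rw [← Set.ncard_coe_finset]
  unfold ballCount
  rw [← Set.ncard_image_of_injective _ (toWord_injective (α := Fin r))]
  refine Set.ncard_le_ncard ?_ ((ball_finite _ n).image _)
  intro l hl
  rw [Finset.mem_coe, mem_words] at hl
  have : (FreeGroup.mk l).toWord = l := by rw [toWord_mk]; exact hl.1.reduce_eq
  exact ⟨FreeGroup.mk l, ⟨trivial, by unfold len; rw [this]; exact hl.2.le⟩, this⟩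

end Helpers

/-- the set of elements whose cyclic reduction contains `v` as a subword is
exponentially generic in `F`. -/
theorem cyclicReduction_subword_expGeneric {r : ℕ} (hr : 2 ≤ r) (v : FreeGroup (Fin r)) :
    ExpGeneric
      {w : FreeGroup (Fin r) | ∃ c : FreeGroup (Fin r), IsCyclicReduction c w ∧ Subword v c}
      (Set.univ : Set (FreeGroup (Fin r))) := by
  classical
  set A : Set (FreeGroup (Fin r)) := {w | ∃ c, IsCyclicReduction c w ∧ Subword v c} with hA
  set q : ℝ := ((2 * r - 1 : ℕ) : ℝ) with hq
  have hq3 : 3 ≤ q := by rw [hq]; exact_mod_cast (show 3 ≤ 2 * r - 1 by omega)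
  obtain ⟨ρ, h1, hlt, hsq, hpow⟩ := exists_rho q hq3 (v.toWord.length + 1) (by omega)
  obtain ⟨C, hC, hav⟩ := avoid_bound hr (FreeGroup.isReduced_toWord (x := v)) ρ h1 hpow
  have hbad := card_bad hr ρ C hC h1 hsq hav
  have hr0 : (0 : ℝ) < r := by exact_mod_cast (show 0 < r by omega)
  have hq0 : 0 < q := by linarith
  obtain ⟨a, ha, b, hab⟩ := exp_bound (2 * r * C) (ρ / q) (by positivity)
    (div_pos (by linarith) hq0) ((div_lt_one hq0).2 hlt)
  refine ⟨a, ha, b, 0, fun n _ => ?_⟩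
  have hU : q ^ n ≤ ballCount (Set.univ : Set (FreeGroup (Fin r))) n := by
    rw [hq]; exact_mod_cast ball_univ_ge n
  have hsplit : ballCount (Set.univ : Set (FreeGroup (Fin r))) n ≤
      ballCount A n + ballCount Aᶜ n := by
    unfold ballCount
    refine le_trans (Set.ncard_le_ncard ?_ ((ball_finite A n).union (ball_finite Aᶜ n)))
      (Set.ncard_union_le _ _)
    rintro w ⟨_, hw⟩
    by_cases h : w ∈ A
    · exact Or.inl ⟨h, hw⟩
    · exact Or.inr ⟨h, hw⟩
  have hB : ballCount Aᶜ n ≤ ∑ m ∈ Finset.range (n + 1), (badWords v.toWord m).card := by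
    unfold ballCount
    rw [← Set.ncard_image_of_injective _ (FreeGroup.toWord_injective (α := Fin r))]
    refine le_trans ?_ (Finset.card_biUnion_le)
    rw [← Set.ncard_coe_finset]
    refine Set.ncard_le_ncard ?_ (Finset.finite_toSet _)
    rintro _ ⟨w, ⟨hwA, hw⟩, rfl⟩
    rw [Finset.mem_coe, Finset.mem_biUnion]
    exact ⟨len w, by rw [Finset.mem_range]; omega, mem_bad v w hwA⟩
  have hB' : (ballCount Aᶜ n : ℝ) ≤ 2 * r * C * ((n : ℝ) + 1) ^ 2 * ρ ^ n := by
    have h0 : (ballCount Aᶜ n : ℝ) ≤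
        ∑ m ∈ Finset.range (n + 1), ((badWords v.toWord m).card : ℝ) := by exact_mod_cast hB
    have h2 : ∀ m ∈ Finset.range (n + 1), ((badWords v.toWord m).card : ℝ) ≤
        ((n : ℝ) + 1) * (2 * r * C * ρ ^ n) := by
      intro m hm
      have hm' : m ≤ n := by rw [Finset.mem_range] at hm; omega
      have hmr : (m : ℝ) ≤ n := by exact_mod_cast hm'
      have hpm : ρ ^ m ≤ ρ ^ n := pow_le_pow_right₀ h1 hm'
      refine (hbad m).trans ?_
      gcongr
    refine h0.trans ((Finset.sum_le_card_nsmul _ _ _ h2).trans (le_of_eq ?_))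
    rw [nsmul_eq_mul, Finset.card_range]
    push_cast
    ring
  have hUpos : (0 : ℝ) < ballCount (Set.univ : Set (FreeGroup (Fin r))) n :=
    lt_of_lt_of_le (by positivity) hU
  rw [le_div_iff₀ hUpos]
  have hsplit' : (ballCount (Set.univ : Set (FreeGroup (Fin r))) n : ℝ) ≤
      ballCount A n + ballCount Aᶜ n := by exact_mod_cast hsplit
  have hfin : (ballCount Aᶜ n : ℝ) ≤ Real.exp (b - a * n) *
      ballCount (Set.univ : Set (FreeGroup (Fin r))) n := by
    calc (ballCount Aᶜ n : ℝ) ≤ 2 * r * C * ((n : ℝ) + 1) ^ 2 * ρ ^ n := hB'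
      _ = (2 * r * C * ((n : ℝ) + 1) ^ 2 * (ρ / q) ^ n) * q ^ n := by
        rw [div_pow]; field_simp
      _ ≤ Real.exp (b - a * n) * q ^ n := by gcongr; exact hab n
      _ ≤ _ := by gcongr
  nlinarith

end VG
end
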